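/- For all x, y in W, the set {xv : v ∈ W, v ≤ y} has a unique minimal element in Bruhat order, denoted x ◁ y, and there exists y₁ ∈ W with y₁ ≤ y, x ◁ y = x y₁, and l(x ◁ y) = l(x) − l(y₁). -/

import Mathlib

/-! Common setup: a finite Coxeter system, Bruhat order, and the sets
`{u * y : u ≤ x}` and `{x * v : v ≤ y}` used to characterize the
Demazure product `∗` and the operations `▷`, `◁`. -/

/-- The Bruhat order on a Coxeter group: the reflexive-transitive closure of
the relation `u → u * t`, where `t` is a reflection and right multiplication
by `t` increases length. -/
def CoxeterSystem.bruhatLE {B W : Type*} [Group W] {M : CoxeterMatrix B}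
    (cs : CoxeterSystem M W) : W → W → Prop :=
  Relation.ReflTransGen
    (fun u v => ∃ t, cs.IsReflection t ∧ v = u * t ∧ cs.length u < cs.length v)

/-- The set `{u * y : u ∈ W, u ≤ x}`. -/
def CoxeterSystem.lset {B W : Type*} [Group W] {M : CoxeterMatrix B}
    (cs : CoxeterSystem M W) (x y : W) : Set W :=
  {z | ∃ u, cs.bruhatLE u x ∧ z = u * y}

/-- The set `{x * v : v ∈ W, v ≤ y}`. -/
def CoxeterSystem.rset {B W : Type*} [Group W] {M : CoxeterMatrix B}
    (cs : CoxeterSystem M W) (x y : W) : Set W :=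
  {z | ∃ v, cs.bruhatLE v y ∧ z = x * v}

namespace CoxeterSystem

variable {B W : Type*} [Group W] {M : CoxeterMatrix B} (cs : CoxeterSystem M W)

/-! ### The reflection cocycle and the strong exchange property -/

theorem leftInvSeq_eq_map_conj_rightInvSeq (ω : List B) :
    cs.leftInvSeq ω = (cs.rightInvSeq ω).map (MulAut.conj (cs.wordProd ω)) := by
  induction ω with
  | nil => simp
  | cons i ω ih =>
    rw [leftInvSeq, rightInvSeq, ih]
    simp [wordProd_cons, mul_assoc]

theorem alternatingWord_two_mul_succ (i j : B) (p : ℕ) :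
    alternatingWord i j (2 * (p + 1)) = i :: j :: alternatingWord i j (2 * p) := by
  rw [mul_add_one, alternatingWord_succ', alternatingWord_succ']
  simp [parity_simps]

theorem drop_leftInvSeq_alternatingWord (i j : B) :
    (cs.leftInvSeq (alternatingWord i j (2 * M i j))).drop (M i j) =
      (cs.leftInvSeq (alternatingWord i j (2 * M i j))).take (M i j) := by
  refine List.ext_getElem (by simp; lia) fun k h₁ h₂ => ?_
  simp only [List.length_take, length_leftInvSeq, length_alternatingWord] at h₂
  rw [List.getElem_drop, List.getElem_take,
    cs.getElem_leftInvSeq_alternatingWord i j _ _ (by lia),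
    cs.getElem_leftInvSeq_alternatingWord i j _ _ (by lia),
    prod_alternatingWord_eq_mul_pow, prod_alternatingWord_eq_mul_pow,
    show (2 * (M i j + k) + 1) / 2 = M i j + k by lia,
    show (2 * k + 1) / 2 = k by lia, pow_add, simple_mul_simple_pow']
  simp [parity_simps]

theorem wordProd_alternatingWord_two_mul (i j : B) :
    cs.wordProd (alternatingWord i j (2 * M i j)) = 1 := by
  rw [prod_alternatingWord_eq_mul_pow]
  simp

open Classical in
theorem even_count_rightInvSeq_alternatingWord (i j : B) (t : W) :
    Even ((cs.rightInvSeq (alternatingWord i j (2 * M i j))).count t) := by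
  have h := cs.leftInvSeq_eq_map_conj_rightInvSeq (alternatingWord i j (2 * M i j))
  rw [wordProd_alternatingWord_two_mul, map_one] at h
  have h' : cs.leftInvSeq (alternatingWord i j (2 * M i j)) =
      cs.rightInvSeq (alternatingWord i j (2 * M i j)) := by
    rw [h]; exact List.map_id _
  rw [← h', ← List.take_append_drop (M i j) (cs.leftInvSeq _), drop_leftInvSeq_alternatingWord,
    List.count_append]
  exact Even.add_self _

open Classical in
/-- The action of a simple reflection on elements of `W` decorated with a sign: conjugation by
`s i`, changing the sign exactly at `s i`. -/
noncomputable def signedConj (i : B) : Function.End (W × ZMod 2) :=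
  fun p => (cs.simple i * p.1 * cs.simple i, p.2 + if p.1 = cs.simple i then 1 else 0)

open Classical in
theorem prod_map_signedConj (ω : List B) (t : W) (e : ZMod 2) :
    (ω.map cs.signedConj).prod (t, e) =
      (cs.wordProd ω * t * (cs.wordProd ω)⁻¹, e + (cs.rightInvSeq ω).count t) := by
  induction ω with
  | nil => simp [Function.End.one_def]
  | cons i ω ih =>
    rw [List.map_cons, List.prod_cons]
    change cs.signedConj i ((ω.map cs.signedConj).prod (t, e)) = _
    rw [ih]
    have : cs.wordProd ω * t * (cs.wordProd ω)⁻¹ = cs.simple i ↔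
        (cs.wordProd ω)⁻¹ * cs.simple i * cs.wordProd ω = t := by
      constructor
      · intro h; rw [← h]; group
      · rintro rfl; group
    simp only [signedConj, rightInvSeq, List.count_cons, wordProd_cons, this, beq_iff_eq]
    ext
    · simp [mul_assoc]
    · push_cast
      simp [add_assoc]

theorem isLiftable_signedConj : M.IsLiftable cs.signedConj := by
  classical
  intro i j
  have h : ∀ p : ℕ, (cs.signedConj i * cs.signedConj j) ^ p =
      ((alternatingWord i j (2 * p)).map cs.signedConj).prod := by
    intro p
    induction p with
    | zero => simp [alternatingWord]
    | succ p ih => rw [alternatingWord_two_mul_succ, pow_succ', ih]; simp [mul_assoc]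
  rw [h]
  funext ⟨t, e⟩
  rw [prod_map_signedConj, wordProd_alternatingWord_two_mul,
    (ZMod.natCast_eq_zero_iff_even).2 (cs.even_count_rightInvSeq_alternatingWord i j t)]
  simp [Function.End.one_def]

theorem lift_signedConj_wordProd (ω : List B) :
    cs.lift ⟨cs.signedConj, cs.isLiftable_signedConj⟩ (cs.wordProd ω) =
      (ω.map cs.signedConj).prod := by
  rw [wordProd, map_list_prod, List.map_map]
  congr 1
  exact List.map_congr_left fun i _ => cs.lift_apply_simple _ i

/-- The parity of the number of occurrences of `t` in the right inversion sequence of any word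
for `w`. -/
noncomputable def inversionParity (w t : W) : ZMod 2 :=
  (cs.lift ⟨cs.signedConj, cs.isLiftable_signedConj⟩ w (t, 0)).2

open Classical in
theorem inversionParity_wordProd (ω : List B) (t : W) :
    cs.inversionParity (cs.wordProd ω) t = (cs.rightInvSeq ω).count t := by
  rw [inversionParity, lift_signedConj_wordProd, prod_map_signedConj, zero_add]

theorem lift_signedConj_apply (w t : W) (e : ZMod 2) :
    cs.lift ⟨cs.signedConj, cs.isLiftable_signedConj⟩ w (t, e) =
      (w * t * w⁻¹, e + cs.inversionParity w t) := by
  classical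
  obtain ⟨ω, rfl⟩ := cs.wordProd_surjective w
  rw [inversionParity_wordProd, lift_signedConj_wordProd, prod_map_signedConj]

theorem inversionParity_mul (v w t : W) :
    cs.inversionParity (v * w) t =
      cs.inversionParity w t + cs.inversionParity v (w * t * w⁻¹) := by
  rw [inversionParity, map_mul]
  change (cs.lift ⟨cs.signedConj, cs.isLiftable_signedConj⟩ v
    (cs.lift ⟨cs.signedConj, cs.isLiftable_signedConj⟩ w (t, 0))).2 = _
  rw [lift_signedConj_apply, lift_signedConj_apply, zero_add]

theorem inversionParity_one (t : W) : cs.inversionParity 1 t = 0 := by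
  simp [inversionParity, Function.End.one_def]

theorem inversionParity_simple_self (i : B) :
    cs.inversionParity (cs.simple i) (cs.simple i) = 1 := by
  simp [inversionParity, signedConj]

theorem IsReflection.inversionParity_self {t : W} (ht : cs.IsReflection t) :
    cs.inversionParity t t = 1 := by
  obtain ⟨w, i, rfl⟩ := ht
  have h := cs.inversionParity_mul w w⁻¹ (w * cs.simple i * w⁻¹)
  rw [mul_inv_cancel, inversionParity_one,
    show w⁻¹ * (w * cs.simple i * w⁻¹) * w⁻¹⁻¹ = cs.simple i by group] at h
  rw [inversionParity_mul, inversionParity_mul,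
    show w⁻¹ * (w * cs.simple i * w⁻¹) * w⁻¹⁻¹ = cs.simple i by group,
    show cs.simple i * cs.simple i * (cs.simple i)⁻¹ = cs.simple i by group,
    inversionParity_simple_self, add_left_comm, ← h, add_zero]

theorem mem_rightInvSeq_of_inversionParity_ne_zero {ω : List B} {t : W}
    (h : cs.inversionParity (cs.wordProd ω) t ≠ 0) : t ∈ cs.rightInvSeq ω := by
  classical
  contrapose! h
  rw [inversionParity_wordProd, List.count_eq_zero_of_not_mem h, Nat.cast_zero]

/-- The strong exchange property. -/
theorem IsRightInversion.mem_rightInvSeq {ω : List B} {t : W}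
    (h : cs.IsRightInversion (cs.wordProd ω) t) : t ∈ cs.rightInvSeq ω := by
  refine cs.mem_rightInvSeq_of_inversionParity_ne_zero fun h₀ => ?_
  obtain ⟨ht, hlt⟩ := h
  obtain ⟨ψ, hψ, hψ'⟩ := cs.exists_isReduced (cs.wordProd ω * t)
  have h₁ : cs.inversionParity (cs.wordProd ψ) t ≠ 0 := by
    rw [← hψ', inversionParity_mul, ht.inversionParity_self, ht.mul_self, one_mul, ht.inv, h₀]
    decide
  have h₂ := cs.isRightInversion_of_mem_rightInvSeq hψ
    (cs.mem_rightInvSeq_of_inversionParity_ne_zero h₁)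
  rw [← hψ', ht.isRightInversion_mul_left_iff] at h₂
  exact h₂ ⟨ht, hlt⟩

/-! ### The lifting property of the Bruhat order -/

theorem IsReflection.length_mul_simple_lt {u t : W} {i : B} (ht : cs.IsReflection t)
    (hlt : cs.length u < cs.length (u * t)) (hne : t ≠ cs.simple i) :
    cs.length (u * cs.simple i) < cs.length (u * t * cs.simple i) := by
  have ht' : cs.IsReflection (cs.simple i * t * cs.simple i) := by
    simpa using ht.conj (cs.simple i)
  have heq : u * cs.simple i * (cs.simple i * t * cs.simple i) = u * t * cs.simple i := by
    simp [← mul_assoc]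
  by_contra hle
  obtain ⟨ω, hω, rfl⟩ := cs.exists_isReduced u
  have hinv : cs.IsRightInversion (cs.wordProd (ω.concat i))
      (cs.simple i * t * cs.simple i) := by
    refine ⟨ht', ?_⟩
    have := ht'.length_mul_left_ne (cs.wordProd ω * cs.simple i)
    rw [wordProd_concat]
    rw [heq] at this ⊢
    lia
  have hmem := hinv.mem_rightInvSeq
  rw [rightInvSeq_concat, List.concat_eq_append, List.mem_append, List.mem_map,
    List.mem_singleton] at hmem
  rcases hmem with ⟨r, hr, hrt⟩ | h
  · have hrt' : r = t := by simpa [mul_assoc] using hrt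
    subst hrt'
    exact hlt.not_gt (cs.isRightInversion_of_mem_rightInvSeq hω hr).2
  · exact hne (by simpa [mul_assoc, mul_eq_one_iff_eq_inv] using h)

theorem bruhatLE_refl (u : W) : cs.bruhatLE u u := Relation.ReflTransGen.refl

variable {cs} in
theorem bruhatLE.trans {u v w : W} (h₁ : cs.bruhatLE u v) (h₂ : cs.bruhatLE v w) :
    cs.bruhatLE u w := Relation.ReflTransGen.trans h₁ h₂

theorem bruhatLE_mul_of_length_lt {u t : W} (ht : cs.IsReflection t)
    (h : cs.length u < cs.length (u * t)) : cs.bruhatLE u (u * t) :=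
  Relation.ReflTransGen.single ⟨t, ht, rfl, h⟩

theorem mul_bruhatLE_of_length_lt {u t : W} (ht : cs.IsReflection t)
    (h : cs.length (u * t) < cs.length u) : cs.bruhatLE (u * t) u := by
  have := cs.bruhatLE_mul_of_length_lt (u := u * t) ht (by simpa [mul_assoc, ht.mul_self] using h)
  simpa [mul_assoc, ht.mul_self] using this

theorem bruhatLE_one_iff {v : W} : cs.bruhatLE v 1 ↔ v = 1 := by
  refine ⟨fun h => ?_, fun h => h ▸ cs.bruhatLE_refl 1⟩
  rcases Relation.ReflTransGen.cases_tail h with h | ⟨_, _, _, _, _, h⟩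
  · exact h.symm
  · simp at h

/-- The shorter of `w` and `w * s i`. -/
noncomputable def mulSimpleMin (w : W) (i : B) : W :=
  if cs.length (w * cs.simple i) < cs.length w then w * cs.simple i else w

/-- The longer of `w` and `w * s i`. -/
noncomputable def mulSimpleMax (w : W) (i : B) : W :=
  if cs.length (w * cs.simple i) < cs.length w then w else w * cs.simple i

theorem mulSimpleMin_eq_or (w : W) (i : B) :
    cs.mulSimpleMin w i = w ∨ cs.mulSimpleMin w i = w * cs.simple i := by
  grind [mulSimpleMin]

theorem mulSimpleMax_eq_or (w : W) (i : B) :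
    cs.mulSimpleMax w i = w ∨ cs.mulSimpleMax w i = w * cs.simple i := by
  grind [mulSimpleMax]

theorem mulSimpleMin_mul_simple (w : W) (i : B) :
    cs.mulSimpleMin (w * cs.simple i) i = cs.mulSimpleMin w i := by
  have := cs.length_mul_simple_ne w i
  simp only [mulSimpleMin, simple_mul_simple_cancel_right]
  split_ifs <;> first | rfl | lia

theorem mulSimpleMax_mul_simple (w : W) (i : B) :
    cs.mulSimpleMax (w * cs.simple i) i = cs.mulSimpleMax w i := by
  have := cs.length_mul_simple_ne w i
  simp only [mulSimpleMax, simple_mul_simple_cancel_right]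
  split_ifs <;> first | rfl | lia

theorem mulSimpleMin_bruhatLE (w : W) (i : B) : cs.bruhatLE (cs.mulSimpleMin w i) w := by
  unfold mulSimpleMin
  split_ifs with h
  · exact cs.mul_bruhatLE_of_length_lt (cs.isReflection_simple i) h
  · exact cs.bruhatLE_refl w

theorem bruhatLE_mulSimpleMax (w : W) (i : B) : cs.bruhatLE w (cs.mulSimpleMax w i) := by
  unfold mulSimpleMax
  split_ifs with h
  · exact cs.bruhatLE_refl w
  · exact cs.bruhatLE_mul_of_length_lt (cs.isReflection_simple i)
      (lt_of_le_of_ne (not_lt.1 h) (cs.length_mul_simple_ne w i).symm)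

theorem mulSimpleMin_bruhatLE_mul (w : W) (i : B) :
    cs.bruhatLE (cs.mulSimpleMin w i) (w * cs.simple i) :=
  cs.mulSimpleMin_mul_simple w i ▸ cs.mulSimpleMin_bruhatLE (w * cs.simple i) i

theorem mul_bruhatLE_mulSimpleMax (w : W) (i : B) :
    cs.bruhatLE (w * cs.simple i) (cs.mulSimpleMax w i) :=
  cs.mulSimpleMax_mul_simple w i ▸ cs.bruhatLE_mulSimpleMax (w * cs.simple i) i

theorem IsReflection.mul_simple_bruhatLE {u t : W} {i : B} (ht : cs.IsReflection t)
    (hlt : cs.length u < cs.length (u * t)) (hne : t ≠ cs.simple i) :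
    cs.bruhatLE (u * cs.simple i) (u * t * cs.simple i) := by
  refine Relation.ReflTransGen.single ⟨cs.simple i * t * cs.simple i, ?_, ?_,
    ht.length_mul_simple_lt cs hlt hne⟩
  · simpa using ht.conj (cs.simple i)
  · simp [← mul_assoc]

variable {cs}

theorem bruhatLE.mulSimpleMin {u v : W} (h : cs.bruhatLE u v) (i : B) :
    cs.bruhatLE (cs.mulSimpleMin u i) (cs.mulSimpleMin v i) := by
  refine Relation.ReflTransGen.lift' (fun w => cs.mulSimpleMin w i) ?_ _ _ h
  rintro a _ ⟨t, ht, rfl, hlt⟩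
  change cs.bruhatLE (cs.mulSimpleMin a i) (cs.mulSimpleMin (a * t) i)
  by_cases hne : t = cs.simple i
  · rw [hne, mulSimpleMin_mul_simple]
    exact cs.bruhatLE_refl _
  rcases cs.mulSimpleMin_eq_or (a * t) i with h | h <;> rw [h]
  · exact (cs.mulSimpleMin_bruhatLE a i).trans (cs.bruhatLE_mul_of_length_lt ht hlt)
  · exact (cs.mulSimpleMin_bruhatLE_mul a i).trans (ht.mul_simple_bruhatLE cs hlt hne)

theorem bruhatLE.mulSimpleMax {u v : W} (h : cs.bruhatLE u v) (i : B) :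
    cs.bruhatLE (cs.mulSimpleMax u i) (cs.mulSimpleMax v i) := by
  refine Relation.ReflTransGen.lift' (fun w => cs.mulSimpleMax w i) ?_ _ _ h
  rintro a _ ⟨t, ht, rfl, hlt⟩
  change cs.bruhatLE (cs.mulSimpleMax a i) (cs.mulSimpleMax (a * t) i)
  by_cases hne : t = cs.simple i
  · rw [hne, mulSimpleMax_mul_simple]
    exact cs.bruhatLE_refl _
  rcases cs.mulSimpleMax_eq_or a i with h | h <;> rw [h]
  · exact (cs.bruhatLE_mul_of_length_lt ht hlt).trans (cs.bruhatLE_mulSimpleMax (a * t) i)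
  · exact (ht.mul_simple_bruhatLE cs hlt hne).trans (cs.mul_bruhatLE_mulSimpleMax (a * t) i)

variable (cs)

/-- The set `{x * v : v ≤ y}` has a least element `x * y₁`, whose length is `ℓ x - ℓ y₁`. -/
theorem exists_bruhatLE_least_mul (x y : W) :
    ∃ y₁, cs.bruhatLE y₁ y ∧ (∀ v, cs.bruhatLE v y → cs.bruhatLE (x * y₁) (x * v)) ∧
      cs.length (x * y₁) + cs.length y₁ = cs.length x := by
  induction hn : cs.length y generalizing y with
  | zero =>
    rw [length_eq_zero_iff] at hn
    subst hn
    refine ⟨1, cs.bruhatLE_refl 1, fun v hv => ?_, by simp⟩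
    rw [cs.bruhatLE_one_iff.1 hv]
    exact cs.bruhatLE_refl _
  | succ n ih =>
    obtain ⟨i, hi⟩ := cs.exists_rightDescent_of_ne_one (w := y) (by rintro rfl; simp at hn)
    have hmin : cs.mulSimpleMin y i = y * cs.simple i := if_pos hi
    have hmax : cs.mulSimpleMax y i = y := if_pos hi
    rw [isRightDescent_iff] at hi
    obtain ⟨y₁, hy₁, hle, hlen⟩ := ih (y * cs.simple i) (by lia)
    have hys : cs.bruhatLE (y * cs.simple i) y := hmin ▸ cs.mulSimpleMin_bruhatLE y i
    have hleast : ∀ v, cs.bruhatLE v y →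
        cs.bruhatLE (cs.mulSimpleMin (x * y₁) i) (x * v) := by
      intro v hv
      have h₁ := hv.mulSimpleMin i
      rw [hmin] at h₁
      have h₂ := (hle _ h₁).mulSimpleMin i
      rcases cs.mulSimpleMin_eq_or v i with h | h <;> rw [h] at h₂
      · exact h₂.trans (cs.mulSimpleMin_bruhatLE _ i)
      · rw [← mul_assoc, mulSimpleMin_mul_simple] at h₂
        exact h₂.trans (cs.mulSimpleMin_bruhatLE _ i)
    by_cases hd : cs.length (x * y₁ * cs.simple i) < cs.length (x * y₁)
    · refine ⟨y₁ * cs.simple i, ?_, ?_, ?_⟩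
      · have := hy₁.mulSimpleMax i
        rw [mulSimpleMax_mul_simple, hmax] at this
        exact (cs.mul_bruhatLE_mulSimpleMax y₁ i).trans this
      · rwa [mulSimpleMin, if_pos hd, mul_assoc] at hleast
      · have h₁ := cs.length_le_length_mul_add_right x (y₁ * cs.simple i)
        have h₂ := cs.length_mul_le y₁ (cs.simple i)
        rw [length_simple] at h₂
        rw [mul_assoc] at hd
        lia
    · exact ⟨y₁, hy₁.trans hys, by rwa [mulSimpleMin, if_neg hd] at hleast, hlen⟩

end CoxeterSystem

/-- For all `x y` in a finite Coxeter group `W`, the set `{x * v : v ≤ y}` has a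
unique minimal element `x ◁ y` in Bruhat order, and `x ◁ y = x * y₁` with
`y₁ ≤ y` and `l(x ◁ y) = l(x) - l(y₁)`. -/
theorem ltr_exists {B W : Type*} [Group W] [Finite W] {M : CoxeterMatrix B}
    (cs : CoxeterSystem M W) (x y : W) :
    ∃ m : W,
      m ∈ cs.rset x y ∧
      (∀ z ∈ cs.rset x y, cs.bruhatLE m z) ∧
      (∀ m' ∈ cs.rset x y, (∀ z ∈ cs.rset x y, cs.bruhatLE z m' → z = m') → m' = m) ∧
      (∃ y₁ : W, cs.bruhatLE y₁ y ∧ m = x * y₁ ∧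
        cs.length m + cs.length y₁ = cs.length x) := by
  obtain ⟨y₁, hy₁, hle, hlen⟩ := cs.exists_bruhatLE_least_mul x y
  have hmem : x * y₁ ∈ cs.rset x y := ⟨y₁, hy₁, rfl⟩
  have hleast : ∀ z ∈ cs.rset x y, cs.bruhatLE (x * y₁) z := by
    rintro _ ⟨v, hv, rfl⟩
    exact hle v hv
  exact ⟨x * y₁, hmem, hleast, fun m' hm' h => (h _ hmem (hleast m' hm')).symm,
    y₁, hy₁, rfl, hlen⟩
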